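/- First three Pless power moments (binary case): let C be an F₂-linear subspace of F₂ⁿ of dimension k ≥ 2, let C^⊥ be its dual code with respect to the standard dot product, and let A_i (resp. A_i^⊥) denote the number of codewords of C (resp. C^⊥) of Hamming weight i. Then: (i) ∑_{j=0}^{n} A_j = 2^k; (ii) ∑_{j=0}^{n} j·A_j = 2^{k−1}·(n − A_1^⊥); (iii) ∑_{j=0}^{n} j²·A_j = 2^{k−2}·(n(n+1) − 2n·A_1^⊥ + 2·A_2^⊥). -/

import Mathlib

/-- The number of codewords of Hamming weight `i` in a code `D ⊆ F₂ⁿ`. -/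
noncomputable def weightCount {F : Type*} [Fintype F] [DecidableEq F] [Zero F] {n : ℕ}
    (D : Set (Fin n → F)) (i : ℕ) : ℕ :=
  Nat.card {x : Fin n → F // x ∈ D ∧ hammingNorm x = i}

/-- The dual code of `C ⊆ Fⁿ` with respect to the standard dot product, as a set. -/
def dualCode {F : Type*} [CommRing F] {n : ℕ} (C : Submodule F (Fin n → F)) :
    Set (Fin n → F) :=
  {x : Fin n → F | ∀ c ∈ C, ∑ i, x i * c i = 0}

open Classical in
lemma weightCount_eq_filter {n : ℕ} (D : Set (Fin n → ZMod 2)) (w : ℕ) :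
    weightCount D w = (Finset.univ.filter (fun x => x ∈ D ∧ hammingNorm x = w)).card := by
  unfold weightCount
  rw [Nat.card_eq_fintype_card, Fintype.card_subtype]

/-- Sign character. -/
def chi (a : ZMod 2) : ℤ := if a = 0 then 1 else -1

lemma chi_add (a b : ZMod 2) : chi (a + b) = chi a * chi b := by
  revert a b; decide

lemma chi_sq (a : ZMod 2) : chi a * chi a = 1 := by
  revert a; decide

/-- Indicator vector. -/
def vec {n : ℕ} (s : Finset (Fin n)) : Fin n → ZMod 2 := fun i => if i ∈ s then 1 else 0

lemma vec_supp {n : ℕ} (s : Finset (Fin n)) :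
    Finset.univ.filter (fun i => vec s i ≠ 0) = s := by
  ext i; simp [vec]

lemma vec_inj {n : ℕ} {s t : Finset (Fin n)} (h : vec s = vec t) : s = t := by
  rw [← vec_supp s, h, vec_supp]

lemma vec_norm {n : ℕ} (s : Finset (Fin n)) : hammingNorm (vec s) = s.card := by
  unfold hammingNorm
  rw [vec_supp]

lemma zmod2_cases (a : ZMod 2) (h : a ≠ 0) : a = 1 := by
  revert a; decide

lemma eq_vec {n : ℕ} (x : Fin n → ZMod 2) :
    x = vec (Finset.univ.filter (fun i => x i ≠ 0)) := by
  funext i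
  by_cases h : x i = 0
  · simp [vec, h]
  · simp [vec, zmod2_cases _ h]

lemma vec_dot {n : ℕ} (s : Finset (Fin n)) (c : Fin n → ZMod 2) :
    ∑ i, vec s i * c i = ∑ i ∈ s, c i := by
  simp [vec]

open Classical in
lemma count_one {n : ℕ} (D : Set (Fin n → ZMod 2)) :
    (weightCount D 1 : ℤ) = ∑ i, if vec {i} ∈ D then 1 else 0 := by
  rw [weightCount_eq_filter, Finset.sum_boole]
  norm_cast
  symm
  refine Finset.card_bij (fun i _ => vec {i}) ?_ ?_ ?_
  · intro i hi
    simpa [vec_norm] using hi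
  · intro i _ j _ h
    simpa using vec_inj h
  · intro x hx
    simp only [Finset.mem_filter, Finset.mem_univ, true_and] at hx
    obtain ⟨a, ha⟩ := Finset.card_eq_one.1 hx.2
    have := eq_vec x
    rw [ha] at this
    exact ⟨a, by simp [← this, hx.1], this.symm⟩

open Classical in
lemma count_two {n : ℕ} (D : Set (Fin n → ZMod 2)) :
    2 * (weightCount D 2 : ℤ) =
      ∑ i, ∑ j, if i ≠ j ∧ vec {i, j} ∈ D then 1 else 0 := by
  rw [weightCount_eq_filter, ← Fintype.sum_prod_type'
    (f := fun i j : Fin n => if i ≠ j ∧ vec {i, j} ∈ D then (1 : ℤ) else 0), Finset.sum_boole]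
  norm_cast
  symm
  rw [Finset.card_eq_sum_card_fiberwise (f := fun p : Fin n × Fin n => vec {p.1, p.2})
    (t := Finset.univ.filter (fun x => x ∈ D ∧ hammingNorm x = 2))]
  · rw [Finset.sum_const_nat (m := 2), mul_comm]
    intro x hx
    simp only [Finset.mem_filter, Finset.mem_univ, true_and] at hx
    obtain ⟨a, b, hab, h⟩ := Finset.card_eq_two.1 hx.2
    have hv := eq_vec x
    rw [h] at hv
    rw [Finset.card_eq_two]
    refine ⟨(a, b), (b, a), by simp [hab], ?_⟩
    ext ⟨i, j⟩
    simp only [Finset.mem_filter, Finset.mem_univ, true_and, Finset.mem_insert,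
      Finset.mem_singleton, Prod.mk.injEq]
    constructor
    · rintro ⟨⟨hij, _⟩, he⟩
      have := vec_inj (he.trans hv)
      have h1 : i ∈ ({a, b} : Finset (Fin n)) := by rw [← this]; simp
      have h2 : j ∈ ({a, b} : Finset (Fin n)) := by rw [← this]; simp
      simp only [Finset.mem_insert, Finset.mem_singleton] at h1 h2
      grind
    · rintro (⟨rfl, rfl⟩ | ⟨rfl, rfl⟩)
      · exact ⟨⟨hab, hv ▸ hx.1⟩, hv.symm⟩
      · rw [Finset.pair_comm]
        exact ⟨⟨hab.symm, hv ▸ hx.1⟩, hv.symm⟩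
  · rintro ⟨i, j⟩ hp
    simp only [Finset.coe_filter, Finset.mem_univ, true_and, Set.mem_setOf_eq] at hp ⊢
    exact ⟨hp.2, by rw [vec_norm, Finset.card_pair hp.1]⟩

open Classical in
lemma char_sum {n : ℕ} (C : Submodule (ZMod 2) (Fin n → ZMod 2)) (s : Finset (Fin n)) :
    ∑ c : C, chi (∑ i ∈ s, (c : Fin n → ZMod 2) i) =
      (Fintype.card C : ℤ) * if vec s ∈ dualCode C then 1 else 0 := by
  split_ifs with h
  · have : ∀ c : C, chi (∑ i ∈ s, (c : Fin n → ZMod 2) i) = 1 := by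
      intro c
      rw [← vec_dot, h c c.2]; rfl
    simp [this]
  · simp only [dualCode, Set.mem_setOf_eq, not_forall] at h
    obtain ⟨c0, hc0, hne⟩ := h
    rw [vec_dot] at hne
    have h1 := Equiv.sum_comp (Equiv.addRight (⟨c0, hc0⟩ : C))
      (fun c : C => chi (∑ i ∈ s, (c : Fin n → ZMod 2) i))
    have h2 : chi (∑ i ∈ s, c0 i) = -1 := by simp [chi, hne]
    simp only [Equiv.coe_addRight, Submodule.coe_add, Pi.add_apply, Finset.sum_add_distrib,
      chi_add, h2] at h1
    rw [← Finset.sum_mul] at h1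
    linarith

open Classical in
lemma moment {n : ℕ} (C : Submodule (ZMod 2) (Fin n → ZMod 2)) (f : ℕ → ℤ) :
    ∑ j ∈ Finset.range (n + 1), f j * (weightCount (C : Set (Fin n → ZMod 2)) j : ℤ) =
      ∑ c : C, f (hammingNorm (c : Fin n → ZMod 2)) := by
  have hc : ∀ j, (weightCount (C : Set (Fin n → ZMod 2)) j : ℤ) =
      ∑ c : C, if hammingNorm (c : Fin n → ZMod 2) = j then 1 else 0 := by
    intro j
    rw [weightCount_eq_filter, Finset.sum_boole]
    norm_cast
    symm
    refine Finset.card_bij (fun c _ => (c : Fin n → ZMod 2)) ?_ ?_ ?_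
    · intro c hc
      simpa using hc
    · intro c _ d _ h
      exact Subtype.ext h
    · intro x hx
      simp only [Finset.mem_filter, Finset.mem_univ, true_and] at hx
      exact ⟨⟨x, hx.1⟩, by simpa using hx.2, rfl⟩
  simp only [hc, Finset.mul_sum]
  rw [Finset.sum_comm]
  refine Finset.sum_congr rfl fun c _ => ?_
  have : hammingNorm (c : Fin n → ZMod 2) < n + 1 := by
    have := hammingNorm_le_card_fintype (x := (c : Fin n → ZMod 2))
    simp at this
    omega
  simp [this]

lemma two_norm {n : ℕ} (c : Fin n → ZMod 2) :
    2 * (hammingNorm c : ℤ) = n - ∑ i, chi (c i) := by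
  have : ∀ i, chi (c i) = 1 - 2 * (if c i ≠ 0 then 1 else 0) := by
    intro i
    by_cases h : c i = 0 <;> simp [chi, h]
  simp only [this, Finset.sum_sub_distrib, ← Finset.mul_sum, Finset.sum_boole, hammingNorm]
  simp

/-- First three Pless power moments for a binary linear code `C ⊆ F₂ⁿ` of
dimension `k ≥ 2`, where `A_i` (resp. `A_i^⊥`) counts weight-`i` codewords of `C`
(resp. of the dual code `C^⊥`):
(i) `∑ A_j = 2^k`;
(ii) `∑ j·A_j = 2^{k−1}(n − A₁^⊥)`;
(iii) `∑ j²·A_j = 2^{k−2}(n(n+1) − 2n·A₁^⊥ + 2·A₂^⊥)`. -/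
theorem pless_power_moments {n k : ℕ}
    (C : Submodule (ZMod 2) (Fin n → ZMod 2))
    (hdim : Module.finrank (ZMod 2) C = k) (hk : 2 ≤ k) :
    (∑ j ∈ Finset.range (n + 1), (weightCount (C : Set (Fin n → ZMod 2)) j : ℤ) = 2 ^ k) ∧
    (∑ j ∈ Finset.range (n + 1), (j : ℤ) * (weightCount (C : Set (Fin n → ZMod 2)) j : ℤ) =
      2 ^ (k - 1) * ((n : ℤ) - (weightCount (dualCode C) 1 : ℤ))) ∧
    (∑ j ∈ Finset.range (n + 1), (j : ℤ) ^ 2 * (weightCount (C : Set (Fin n → ZMod 2)) j : ℤ) =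
      2 ^ (k - 2) * ((n : ℤ) * ((n : ℤ) + 1) - 2 * (n : ℤ) * (weightCount (dualCode C) 1 : ℤ)
        + 2 * (weightCount (dualCode C) 2 : ℤ))) := by
  classical
  have hcard : (Fintype.card C : ℤ) = 2 ^ k := by
    have := Module.card_eq_pow_finrank (K := ZMod 2) (V := C)
    rw [this, hdim, ZMod.card]
    norm_cast
  have S1 : ∑ c : C, ∑ i, chi ((c : Fin n → ZMod 2) i) =
      2 ^ k * (weightCount (dualCode C) 1 : ℤ) := by
    rw [Finset.sum_comm, count_one, Finset.mul_sum]
    refine Finset.sum_congr rfl fun i _ => ?_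
    have := char_sum C {i}
    simpa [hcard] using this
  have S2 : ∑ c : C, (∑ i, chi ((c : Fin n → ZMod 2) i)) ^ 2 =
      2 ^ k * (n + 2 * (weightCount (dualCode C) 2 : ℤ)) := by
    have hn : (n : ℤ) = ∑ i : Fin n, ∑ j : Fin n, if i = j then 1 else 0 := by simp
    rw [count_two, hn, ← Finset.sum_add_distrib, Finset.mul_sum]
    simp only [sq, Finset.sum_mul_sum]
    rw [Finset.sum_comm]
    refine Finset.sum_congr rfl fun i _ => ?_
    rw [Finset.sum_comm, ← Finset.sum_add_distrib, Finset.mul_sum]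
    refine Finset.sum_congr rfl fun j _ => ?_
    by_cases hij : i = j
    · subst hij
      simp [chi_sq, hcard]
    · have := char_sum C {i, j}
      simp only [Finset.sum_pair hij, chi_add] at this
      rw [this, hcard]
      simp [hij]
  refine ⟨?_, ?_, ?_⟩
  · have := moment C (fun _ => 1)
    simpa [hcard] using this
  · rw [moment C (fun j => (j : ℤ))]
    obtain ⟨m, rfl⟩ : ∃ m, k = m + 2 := ⟨k - 2, by omega⟩
    have h : 2 * ∑ c : C, (hammingNorm (c : Fin n → ZMod 2) : ℤ) =
        2 ^ (m + 2) * n - 2 ^ (m + 2) * (weightCount (dualCode C) 1 : ℤ) := by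
      rw [← S1, ← hcard, Finset.mul_sum]
      simp only [two_norm, Finset.sum_sub_distrib]
      simp
    have e : m + 2 - 1 = m + 1 := by omega
    rw [e]
    rw [pow_succ] at h
    linarith
  · rw [moment C (fun j => (j : ℤ) ^ 2)]
    obtain ⟨m, rfl⟩ : ∃ m, k = m + 2 := ⟨k - 2, by omega⟩
    have h : 4 * ∑ c : C, (hammingNorm (c : Fin n → ZMod 2) : ℤ) ^ 2 =
        2 ^ (m + 2) * (n : ℤ) ^ 2 - 2 * n * (2 ^ (m + 2) * (weightCount (dualCode C) 1 : ℤ))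
          + 2 ^ (m + 2) * (n + 2 * (weightCount (dualCode C) 2 : ℤ)) := by
      rw [← S1, ← S2, ← hcard, Finset.mul_sum, Finset.mul_sum]
      have hx : ∀ c : C, 4 * (hammingNorm (c : Fin n → ZMod 2) : ℤ) ^ 2 =
          (n : ℤ) ^ 2 - 2 * n * (∑ i, chi ((c : Fin n → ZMod 2) i))
            + (∑ i, chi ((c : Fin n → ZMod 2) i)) ^ 2 := by
        intro c
        have := two_norm (c : Fin n → ZMod 2)
        calc _ = (2 * (hammingNorm (c : Fin n → ZMod 2) : ℤ)) ^ 2 := by ring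
          _ = _ := by rw [this]; ring
      simp only [hx, Finset.sum_sub_distrib, Finset.sum_add_distrib]
      simp
    have e : m + 2 - 2 = m := by omega
    rw [e]
    rw [pow_add] at h
    linarith
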